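/- (t-SVD existence) Let X be a third-order real tensor of size n₁×n₂×n₃ with frontal slices X^{(k)} ∈ ℝ^{n₁×n₂}, k ∈ ℤ/n₃ℤ. Then there exist real third-order tensors U of size n₁×n₁×n₃, S of size n₁×n₂×n₃, and V of size n₂×n₂×n₃ such that: (i) bcirc(U) and bcirc(V) are orthogonal matrices, i.e., bcirc(U)·bcirc(U)ᵀ = I and bcirc(V)·bcirc(V)ᵀ = I; (ii) S is f-diagonal, i.e., every frontal slice S^{(k)} is a diagonal matrix; and (iii) bcirc(X) = bcirc(U) · bcirc(S) · bcirc(V)ᵀ. -/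

import Mathlib

open Matrix Finset

/-- The block circulant matrix of a third-order real tensor given by its frontal slices
`X k : Matrix (Fin n₁) (Fin n₂) ℝ`, `k : ZMod n₃`: its `(i, j)`-th `n₁ × n₂` block is
`X (i - j)`. -/
def bcirc {n₁ n₂ n₃ : ℕ} (X : ZMod n₃ → Matrix (Fin n₁) (Fin n₂) ℝ) :
    Matrix (ZMod n₃ × Fin n₁) (ZMod n₃ × Fin n₂) ℝ :=
  Matrix.of fun p q => X (p.1 - q.1) p.2 q.2

open ZMod in
/-- Fourier transform of a real tensor along the third mode. -/
noncomputable def tH {m n N : ℕ} [NeZero N] (X : ZMod N → Matrix (Fin m) (Fin n) ℝ) :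
    ZMod N → Matrix (Fin m) (Fin n) ℂ :=
  ZMod.dft (fun j => (X j).map (fun x : ℝ => (x : ℂ)))

/-- The t-product in convolution form. -/
def tconv {m n p N : ℕ} [NeZero N] (X : ZMod N → Matrix (Fin m) (Fin n) ℝ)
    (Y : ZMod N → Matrix (Fin n) (Fin p) ℝ) : ZMod N → Matrix (Fin m) (Fin p) ℝ :=
  fun k => ∑ j, X (k - j) * Y j

/-- Tensor transpose. -/
def ttr {m n N : ℕ} (X : ZMod N → Matrix (Fin m) (Fin n) ℝ) :
    ZMod N → Matrix (Fin n) (Fin m) ℝ := fun k => (X (-k))ᵀ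

theorem bcirc_mul {m n p N : ℕ} [NeZero N] (X : ZMod N → Matrix (Fin m) (Fin n) ℝ)
    (Y : ZMod N → Matrix (Fin n) (Fin p) ℝ) : bcirc X * bcirc Y = bcirc (tconv X Y) := by
  ext ⟨i, a⟩ ⟨j, b⟩
  simp only [bcirc, tconv, Matrix.mul_apply, Matrix.of_apply, Fintype.sum_prod_type,
    Matrix.sum_apply]
  refine Fintype.sum_equiv (Equiv.subRight j) _ _ fun l => ?_
  simp

theorem bcirc_tr {m n N : ℕ} (X : ZMod N → Matrix (Fin m) (Fin n) ℝ) :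
    (bcirc X)ᵀ = bcirc (ttr X) := by
  ext ⟨i, a⟩ ⟨j, b⟩
  simp [bcirc, ttr]

theorem bcirc_one {n N : ℕ} [NeZero N] :
    bcirc (Pi.single (0 : ZMod N) (1 : Matrix (Fin n) (Fin n) ℝ)) = 1 := by
  ext ⟨i, a⟩ ⟨j, b⟩
  by_cases h : i = j
  · subst h
    simp [bcirc, Matrix.one_apply]
  · simp [bcirc, Matrix.one_apply, Pi.single_apply, sub_eq_zero, h]

theorem tH_apply {m n N : ℕ} [NeZero N] (X : ZMod N → Matrix (Fin m) (Fin n) ℝ) (k : ZMod N)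
    (a : Fin m) (b : Fin n) :
    tH X k a b = ∑ j, ZMod.stdAddChar (-(j * k)) * (X j a b : ℂ) := by
  simp [tH, ZMod.dft_apply, Matrix.sum_apply]

theorem tH_injective {m n N : ℕ} [NeZero N] :
    Function.Injective (tH : (ZMod N → Matrix (Fin m) (Fin n) ℝ) → _) := by
  intro X Y h
  have := ZMod.dft.injective h
  funext k
  ext a b
  have h2 := congrFun (congrFun (congrFun this k) a) b
  simpa using h2

theorem tH_conv {m n p N : ℕ} [NeZero N] (X : ZMod N → Matrix (Fin m) (Fin n) ℝ)
    (Y : ZMod N → Matrix (Fin n) (Fin p) ℝ) (k : ZMod N) :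
    tH (tconv X Y) k = tH X k * tH Y k := by
  ext a b
  simp only [tH_apply, Matrix.mul_apply, tconv, Matrix.sum_apply, Complex.ofReal_sum,
    Complex.ofReal_mul, Finset.mul_sum, Finset.sum_mul]
  rw [Finset.sum_comm]
  conv_rhs => rw [Finset.sum_comm]
  refine Finset.sum_congr rfl fun j _ => ?_
  conv_rhs => rw [Finset.sum_comm]
  refine Fintype.sum_equiv (Equiv.subRight j) _ _ fun l => ?_
  refine Finset.sum_congr rfl fun c _ => ?_
  have : ZMod.stdAddChar (-(l * k)) =
      ZMod.stdAddChar (-((l - j) * k)) * ZMod.stdAddChar (-(j * k)) := by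
    rw [← AddChar.map_add_eq_mul]; congr 1; ring
  simp only [Equiv.subRight_apply]
  rw [this]; ring

theorem conj_stdAddChar {N : ℕ} [NeZero N] (k : ZMod N) :
    (starRingEnd ℂ) (ZMod.stdAddChar k) = ZMod.stdAddChar (-k) := by
  rw [AddChar.map_neg_eq_inv, ZMod.stdAddChar_apply, ← Circle.coe_inv_eq_conj, Circle.coe_inv]

theorem tH_tr {m n N : ℕ} [NeZero N] (X : ZMod N → Matrix (Fin m) (Fin n) ℝ) (k : ZMod N) :
    tH (ttr X) k = (tH X k)ᴴ := by
  ext a b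
  simp only [tH_apply, ttr, Matrix.conjTranspose_apply, Matrix.transpose_apply,
    ← starRingEnd_apply, map_sum, map_mul, conj_stdAddChar, Complex.conj_ofReal]
  refine Fintype.sum_equiv (Equiv.neg _) _ _ fun l => ?_
  simp

theorem tH_neg {m n N : ℕ} [NeZero N] (X : ZMod N → Matrix (Fin m) (Fin n) ℝ) (k : ZMod N) :
    tH X (-k) = (tH X k).map (starRingEnd ℂ) := by
  ext a b
  simp only [tH_apply, Matrix.map_apply, map_sum, map_mul, conj_stdAddChar, Complex.conj_ofReal]
  simp

theorem tH_one {n N : ℕ} [NeZero N] (k : ZMod N) :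
    tH (Pi.single (0 : ZMod N) (1 : Matrix (Fin n) (Fin n) ℝ)) k = 1 := by
  ext a b
  rw [tH_apply, Finset.sum_eq_single 0]
  · by_cases h : a = b <;> simp [h, Matrix.one_apply]
  · intro j _ hj
    simp [hj]
  · simp

/-- Descent: conjugate-symmetric complex tensors come from real tensors. -/
theorem tH_surj {m n N : ℕ} [NeZero N] (Φ : ZMod N → Matrix (Fin m) (Fin n) ℂ)
    (h : ∀ k, Φ (-k) = (Φ k).map (starRingEnd ℂ)) :
    ∃ X : ZMod N → Matrix (Fin m) (Fin n) ℝ, tH X = Φ ∧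
      ∀ a b, (∀ k, Φ k a b = 0) → ∀ k, X k a b = 0 := by
  have key : ∀ k a b, ZMod.dft.symm Φ k a b =
      (N : ℂ)⁻¹ * ∑ j, ZMod.stdAddChar (j * k) * Φ j a b := by
    intro k a b
    simp [ZMod.invDFT_apply, Matrix.sum_apply]
  refine ⟨fun k => (ZMod.dft.symm Φ k).map Complex.re, ?_, ?_⟩
  · rw [tH, ← LinearEquiv.eq_symm_apply]
    funext k
    ext a b
    simp only [Matrix.map_apply]
    rw [← Complex.conj_eq_iff_re, key]
    simp only [map_mul, map_inv₀, map_sum, conj_stdAddChar, Complex.conj_natCast]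
    congr 1
    refine Fintype.sum_equiv (Equiv.neg _) _ _ fun l => ?_
    simp [h]
  · intro a b h0 k
    simp [key, h0]

open Module in
theorem svd_lin {𝕜 : Type*} [RCLike 𝕜] {m n : ℕ}
    (T : EuclideanSpace 𝕜 (Fin n) →ₗ[𝕜] EuclideanSpace 𝕜 (Fin m)) :
    ∃ (u : OrthonormalBasis (Fin m) 𝕜 (EuclideanSpace 𝕜 (Fin m)))
      (v : OrthonormalBasis (Fin n) 𝕜 (EuclideanSpace 𝕜 (Fin n))),
      ∀ (a : Fin m) (b : Fin n), (a : ℕ) ≠ (b : ℕ) → inner 𝕜 (u a) (T (v b)) = 0 := by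
  have hn : finrank 𝕜 (EuclideanSpace 𝕜 (Fin n)) = n := by simp
  have hm : finrank 𝕜 (EuclideanSpace 𝕜 (Fin m)) = Fintype.card (Fin m) := by simp
  have hT := T.isSymmetric_adjoint_comp_self
  let v := hT.eigenvectorBasis hn
  have hin : ∀ i j, inner 𝕜 (T (v i)) (T (v j)) =
      (hT.eigenvalues hn j : 𝕜) * inner 𝕜 (v i) (v j) := by
    intro i j
    rw [← LinearMap.adjoint_inner_right, ← LinearMap.comp_apply, hT.apply_eigenvectorBasis hn j,
      inner_smul_right]
  have horth : ∀ i j, i ≠ j → inner 𝕜 (T (v i)) (T (v j)) = 0 := by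
    intro i j hij
    rw [hin, v.orthonormal.2 hij, mul_zero]
  have hz : ∀ j : Fin n, m ≤ (j : ℕ) → T (v j) = 0 := by
    intro j hj
    have h1 : T.singularValues j = 0 := by
      rw [LinearMap.singularValues_eq_zero_iff_le_finrank_range]
      refine le_trans (Submodule.finrank_le _) ?_
      simpa using hj
    have h2 := T.sq_singularValues_fin hn j
    rw [h1] at h2
    rw [← inner_self_eq_zero (𝕜 := 𝕜), hin, ← h2]
    simp
  let w : Fin m → EuclideanSpace 𝕜 (Fin m) := fun i =>
    if h : (i : ℕ) < n then ((‖T (v ⟨i, h⟩)‖ : 𝕜)⁻¹) • T (v ⟨i, h⟩) else 0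
  let s : Set (Fin m) := {i | ∃ h : (i : ℕ) < n, T (v ⟨i, h⟩) ≠ 0}
  have hw : Orthonormal 𝕜 (s.domRestrict w) := by
    constructor
    · rintro ⟨i, hi, hne⟩
      simp only [Set.domRestrict_apply, w, hi, dif_pos]
      exact norm_smul_inv_norm hne
    · rintro ⟨i, hi, hne⟩ ⟨j, hj, hne'⟩ hij
      simp only [Set.domRestrict_apply, w, hi, hj, dif_pos]
      rw [inner_smul_left, inner_smul_right, horth]
      · simp
      · intro h
        apply hij
        simp only [Fin.mk.injEq] at h
        exact Subtype.ext (Fin.ext h)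
  obtain ⟨u, hu⟩ := hw.exists_orthonormalBasis_extension_of_card_eq hm
  refine ⟨u, v, fun a b hab => ?_⟩
  by_cases h0 : T (v b) = 0
  · rw [h0, inner_zero_right]
  have hb : (b : ℕ) < m := by
    by_contra h
    exact h0 (hz b (not_lt.mp h))
  have hbs : (⟨b, hb⟩ : Fin m) ∈ s := ⟨b.2, h0⟩
  have hub := hu _ hbs
  have hwb : w ⟨b, hb⟩ = ((‖T (v b)‖ : 𝕜)⁻¹) • T (v b) := by simp [w]
  have hTb : T (v b) = (‖T (v b)‖ : 𝕜) • u ⟨b, hb⟩ := by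
    rw [hub, hwb, smul_smul, mul_inv_cancel₀, one_smul]
    simpa using h0
  rw [hTb, inner_smul_right, u.orthonormal.2, mul_zero]
  intro h
  exact hab (congrArg Fin.val h)

/-- Matrix of an orthonormal basis. -/
theorem onb_unitary {𝕜 : Type*} [RCLike 𝕜] {m : ℕ}
    (u : OrthonormalBasis (Fin m) 𝕜 (EuclideanSpace 𝕜 (Fin m))) :
    (Matrix.of fun i j => u j i)ᴴ * (Matrix.of fun i j => u j i) = 1 := by
  ext a b
  have := orthonormal_iff_ite.mp u.orthonormal a b
  rw [PiLp.inner_apply] at this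
  simp only [Matrix.mul_apply, Matrix.conjTranspose_apply, Matrix.of_apply, Matrix.one_apply]
  rw [← this]
  refine Finset.sum_congr rfl fun i _ => ?_
  simp [mul_comm]

theorem svd_matrix {𝕜 : Type*} [RCLike 𝕜] {m n : ℕ} (A : Matrix (Fin m) (Fin n) 𝕜) :
    ∃ (U : Matrix (Fin m) (Fin m) 𝕜) (S : Matrix (Fin m) (Fin n) 𝕜)
      (V : Matrix (Fin n) (Fin n) 𝕜), U * Uᴴ = 1 ∧ V * Vᴴ = 1 ∧
      (∀ (a : Fin m) (b : Fin n), (a : ℕ) ≠ (b : ℕ) → S a b = 0) ∧ A = U * S * Vᴴ := by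
  obtain ⟨u, v, h⟩ := svd_lin (Matrix.toLpLin 2 2 A)
  have hU := onb_unitary u
  have hV := onb_unitary v
  set U : Matrix (Fin m) (Fin m) 𝕜 := Matrix.of fun i j => u j i with hUd
  set V : Matrix (Fin n) (Fin n) 𝕜 := Matrix.of fun i j => v j i with hVd
  have hU' : U * Uᴴ = 1 := mul_eq_one_comm.mp hU
  have hV' : V * Vᴴ = 1 := mul_eq_one_comm.mp hV
  refine ⟨U, Uᴴ * (A * V), V, hU', hV', fun a b hab => ?_, ?_⟩
  · rw [← h a b hab, PiLp.inner_apply, Matrix.mul_apply]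
    refine Finset.sum_congr rfl fun i _ => ?_
    simp [hUd, hVd, Matrix.mul_apply, Matrix.mulVec, dotProduct, mul_comm]
  · rw [← Matrix.mul_assoc U, hU', Matrix.one_mul, Matrix.mul_assoc, hV', Matrix.mul_one]

/-- Conjugation-equivariant choice over `ZMod N`. -/
theorem equivariant_choice {N : ℕ} [NeZero N] {τ : Type*} (c : τ → τ) (hc : ∀ t, c (c t) = t)
    (P : ZMod N → τ → Prop) (h1 : ∀ k, ∃ t, P k t) (h2 : ∀ k t, P k t → P (-k) (c t))
    (h3 : ∀ k, -k = k → ∃ t, P k t ∧ c t = t) :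
    ∃ f : ZMod N → τ, ∀ k, P k (f k) ∧ f (-k) = c (f k) := by
  choose g hg using h1
  choose e he hce using h3
  refine ⟨fun k => if h : -k = k then e k h else
    if k.val < (-k).val then g k else c (g (-k)), fun k => ?_⟩
  by_cases h : -k = k
  · have h' : - -k = -k := by rw [h]; exact h
    refine ⟨by simpa [h] using he k h, ?_⟩
    simp only [h, dif_pos, hce]
  · have h' : ¬ (k = -k) := fun q => h q.symm
    have hne : k.val ≠ (-k).val := fun q => h' (ZMod.val_injective N q)
    simp only [h, neg_neg, h', dif_neg, not_false_eq_true]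
    by_cases hl : k.val < (-k).val
    · have hl' : ¬ ((-k).val < k.val) := by omega
      simp only [hl, hl', if_true, if_false]
      exact ⟨hg k, trivial⟩
    · have hl' : (-k).val < k.val := by omega
      simp only [hl, hl', if_true, if_false, hc]
      refine ⟨?_, trivial⟩
      simpa using h2 _ _ (hg (-k))

/-- **Existence of the t-SVD.**  Every third-order real tensor `X` (given by its frontal
slices) factors as `bcirc X = bcirc U * bcirc S * (bcirc V)ᵀ`, where `bcirc U` and
`bcirc V` are orthogonal matrices and `S` is f-diagonal (every frontal slice of `S`
is a diagonal matrix). -/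
theorem tSVD_exists (n₁ n₂ n₃ : ℕ) [NeZero n₃]
    (X : ZMod n₃ → Matrix (Fin n₁) (Fin n₂) ℝ) :
    ∃ (U : ZMod n₃ → Matrix (Fin n₁) (Fin n₁) ℝ)
      (S : ZMod n₃ → Matrix (Fin n₁) (Fin n₂) ℝ)
      (V : ZMod n₃ → Matrix (Fin n₂) (Fin n₂) ℝ),
      bcirc U * (bcirc U)ᵀ = 1 ∧
      bcirc V * (bcirc V)ᵀ = 1 ∧
      (∀ (k : ZMod n₃) (a : Fin n₁) (b : Fin n₂), (a : ℕ) ≠ (b : ℕ) → S k a b = 0) ∧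
      bcirc X = bcirc U * bcirc S * (bcirc V)ᵀ := by
  have hct : ∀ {p q : ℕ} (M : Matrix (Fin p) (Fin q) ℂ),
      (M.map (starRingEnd ℂ))ᴴ = Mᴴ.map (starRingEnd ℂ) := by
    intro p q M; ext a b; simp
  have hcr : ∀ {p q : ℕ} (M : Matrix (Fin p) (Fin q) ℝ),
      (M.map Complex.ofRealHom)ᴴ = Mᴴ.map Complex.ofRealHom := by
    intro p q M; ext a b; simp
  have hrr : ∀ {p q : ℕ} (M : Matrix (Fin p) (Fin q) ℝ),
      (M.map Complex.ofRealHom).map (starRingEnd ℂ) = M.map Complex.ofRealHom := by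
    intro p q M; ext a b; simp
  have hcc : ∀ {p q : ℕ} (M : Matrix (Fin p) (Fin q) ℂ),
      (M.map (starRingEnd ℂ)).map (starRingEnd ℂ) = M := by
    intro p q M; ext a b; simp
  obtain ⟨f, hf⟩ := equivariant_choice (N := n₃)
    (τ := Matrix (Fin n₁) (Fin n₁) ℂ × Matrix (Fin n₁) (Fin n₂) ℂ × Matrix (Fin n₂) (Fin n₂) ℂ)
    (fun t => (t.1.map (starRingEnd ℂ), t.2.1.map (starRingEnd ℂ), t.2.2.map (starRingEnd ℂ)))
    (fun t => by simp only [hcc])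
    (fun k t => t.1 * t.1ᴴ = 1 ∧ t.2.2 * t.2.2ᴴ = 1 ∧
      (∀ (a : Fin n₁) (b : Fin n₂), (a : ℕ) ≠ (b : ℕ) → t.2.1 a b = 0) ∧ tH X k = t.1 * t.2.1 * t.2.2ᴴ)
    (fun k => by
      obtain ⟨U, S, V, h⟩ := svd_matrix (tH X k)
      exact ⟨(U, S, V), h⟩)
    (by
      rintro k ⟨U, S, V⟩ ⟨hU, hV, hS, h⟩
      dsimp only at hU hV hS h ⊢
      refine ⟨?_, ?_, ?_, ?_⟩
      · rw [hct, ← Matrix.map_mul, hU, Matrix.map_one _ (map_zero _) (map_one _)]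
      · rw [hct, ← Matrix.map_mul, hV, Matrix.map_one _ (map_zero _) (map_one _)]
      · intro a b hab
        simp [hS a b hab]
      · rw [hct, ← Matrix.map_mul, ← Matrix.map_mul, ← h, tH_neg])
    (by
      intro k hk
      obtain ⟨U, S, V, hU, hV, hS, h⟩ := svd_matrix ((tH X k).map Complex.re)
      refine ⟨(U.map Complex.ofRealHom, S.map Complex.ofRealHom, V.map Complex.ofRealHom),
        ⟨?_, ?_, ?_, ?_⟩, ?_⟩
      · dsimp only
        rw [hcr, ← Matrix.map_mul, hU, Matrix.map_one _ (map_zero _) (map_one _)]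
      · dsimp only
        rw [hcr, ← Matrix.map_mul, hV, Matrix.map_one _ (map_zero _) (map_one _)]
      · intro a b hab
        simp [hS a b hab]
      · dsimp only
        rw [hcr, ← Matrix.map_mul, ← Matrix.map_mul, ← h]
        have hn := tH_neg X k
        rw [hk] at hn
        ext a b
        have := congrFun (congrFun hn a) b
        exact (Complex.conj_eq_iff_re.mp this.symm).symm
      · simp only [hrr])
  obtain ⟨U, hU, -⟩ := tH_surj (fun k => (f k).1) (fun k => by rw [(hf k).2])
  obtain ⟨S, hS, hS0⟩ := tH_surj (fun k => (f k).2.1) (fun k => by rw [(hf k).2])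
  obtain ⟨V, hV, -⟩ := tH_surj (fun k => (f k).2.2) (fun k => by rw [(hf k).2])
  refine ⟨U, S, V, ?_, ?_, ?_, ?_⟩
  · rw [bcirc_tr, bcirc_mul, ← bcirc_one]
    congr 1
    apply tH_injective
    funext k
    rw [tH_conv, tH_tr, tH_one, hU]
    exact (hf k).1.1
  · rw [bcirc_tr, bcirc_mul, ← bcirc_one]
    congr 1
    apply tH_injective
    funext k
    rw [tH_conv, tH_tr, tH_one, hV]
    exact (hf k).1.2.1
  · intro k a b hab
    exact hS0 a b (fun k => (hf k).1.2.2.1 a b hab) k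
  · rw [bcirc_tr, bcirc_mul, bcirc_mul]
    congr 1
    apply tH_injective
    funext k
    rw [tH_conv, tH_conv, tH_tr, hU, hS, hV]
    exact (hf k).1.2.2.2
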